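/- arXiv:2311.03723 — 6 statements merged into one kernel-verified Lean document; each statement's English description precedes it below -/
import Mathlib

section
/- Fix a real number ν ≥ 0 and natural numbers τc, τq with τ = τc + τq. Fix a set T_q ⊆ {1,…,τ} with |T_q| = τq ('quantum' steps) and let T_c = {1,…,τ} \ T_q ('classical' steps, |T_c| = τc). Let (z_t)_{0 ≤ t < τ} be real numbers and define sequences (a_t)_{0 ≤ t ≤ τ} and (b_t)_{0 ≤ t ≤ τ} by: a_0 = 1, b_0 = 0; if t+1 ∈ T_c then a_{t+1} = a_t − 2ν − 2√ν·√(z_t) and b_{t+1} = b_t + ν − z_t; if t+1 ∈ T_q then a_{t+1} = a_t − 4ν − 4√ν·√(b_t) and b_{t+1} = b_t + 4ν + 4√ν·√(b_t). Assume 0 ≤ z_t ≤ b_t for all 0 ≤ t < τ. Then a_τ ≥ 1 − 4ν·(√τc + τq)² and b_τ ≤ ν·(√τc + 2τq)². -/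
/-- Bounds on the state `(a, b)` of the recursion after `c` classical and `q` quantum steps, where
`Z` and `W` are the sums of `z` and of `√z` over the classical steps. -/
structure ProgressBound (ν a b : ℝ) (c q : ℕ) (W Z : ℝ) : Prop where
  b_nonneg : 0 ≤ b
  sum_nonneg : 0 ≤ Z
  sq_sum_sqrt_le : W ^ 2 ≤ c * Z
  add_le : b + Z ≤ ν * (√c + 2 * q) ^ 2
  one_sub_eq : 1 - a = b + c * ν + 2 * √ν * W + Z

namespace ProgressBound

variable {ν a b W Z : ℝ} {c q : ℕ}

theorem classical_step (h : ProgressBound ν a b c q W Z) (hν : 0 ≤ ν) {z : ℝ} (hz : 0 ≤ z)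
    (hzb : z ≤ b) :
    ProgressBound ν (a - 2 * ν - 2 * √ν * √z) (b + ν - z) (c + 1) q (W + √z) (Z + z) where
  b_nonneg := by linarith
  sum_nonneg := add_nonneg h.sum_nonneg hz
  sq_sum_sqrt_le := by
    have hsq := Real.sq_sqrt hz
    have hZ := h.sum_nonneg
    have hcross : 2 * W * √z ≤ c * z + Z := by
      refine le_of_sq_le_sq ?_ (by positivity)
      have := mul_le_mul_of_nonneg_right h.sq_sum_sqrt_le hz
      calc (2 * W * √z) ^ 2 = 4 * (W ^ 2 * z) := by rw [mul_pow, hsq]; ring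
        _ ≤ (c * z + Z) ^ 2 := by nlinarith [sq_nonneg (c * z - Z)]
    push_cast
    linarith [h.sq_sum_sqrt_le, add_sq W (√z)]
  add_le := by
    have hmono : √(c : ℝ) ≤ √((c + 1 : ℕ) : ℝ) := Real.sqrt_le_sqrt (by simp)
    have hc : √(c : ℝ) ^ 2 = c := Real.sq_sqrt (by positivity)
    have hc' : √((c + 1 : ℕ) : ℝ) ^ 2 = c + 1 := by
      rw [Real.sq_sqrt (by positivity)]; push_cast; ring
    have hq := mul_le_mul_of_nonneg_left hmono (Nat.cast_nonneg (α := ℝ) q)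
    have : (√(c : ℝ) + 2 * q) ^ 2 + 1 ≤ (√((c + 1 : ℕ) : ℝ) + 2 * q) ^ 2 := by
      linarith [add_sq (√(c : ℝ)) (2 * q), add_sq (√((c + 1 : ℕ) : ℝ)) (2 * q)]
    linarith [mul_le_mul_of_nonneg_left this hν, h.add_le]
  one_sub_eq := by
    push_cast
    linarith [h.one_sub_eq]

theorem sqrt_le (h : ProgressBound ν a b c q W Z) (hν : 0 ≤ ν) {x : ℝ} (hx : x ≤ b + Z) :
    √x ≤ √ν * (√c + 2 * q) := by
  refine Real.sqrt_le_iff.mpr ⟨by positivity, ?_⟩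
  rw [mul_pow, Real.sq_sqrt hν]
  exact hx.trans h.add_le

theorem quantum_step (h : ProgressBound ν a b c q W Z) (hν : 0 ≤ ν) :
    ProgressBound ν (a - 4 * ν - 4 * √ν * √b) (b + 4 * ν + 4 * √ν * √b) c (q + 1) W Z where
  b_nonneg := by
    have := h.b_nonneg
    positivity
  sum_nonneg := h.sum_nonneg
  sq_sum_sqrt_le := h.sq_sum_sqrt_le
  add_le := by
    have hb := mul_le_mul_of_nonneg_left
      (h.sqrt_le hν (x := b) (by linarith [h.sum_nonneg])) (Real.sqrt_nonneg ν)
    rw [← mul_assoc, Real.mul_self_sqrt hν] at hb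
    push_cast
    linarith [h.add_le]
  one_sub_eq := by linarith [h.one_sub_eq]

theorem le_left (h : ProgressBound ν a b c q W Z) (hν : 0 ≤ ν) :
    1 - 4 * ν * (√c + q) ^ 2 ≤ a := by
  have hW : W ≤ √c * √Z := by
    rw [← Real.sqrt_mul (Nat.cast_nonneg c)]
    exact Real.le_sqrt_of_sq_le h.sq_sum_sqrt_le
  have hZ := h.sqrt_le hν (x := Z) (by linarith [h.b_nonneg])
  have hνW : √ν * W ≤ ν * (√c * (√c + 2 * q)) :=
    calc √ν * W ≤ √ν * (√c * (√ν * (√c + 2 * q))) := by gcongr; exact hW.trans (by gcongr)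
      _ = √ν * √ν * (√c * (√c + 2 * q)) := by ring
      _ = ν * (√c * (√c + 2 * q)) := by rw [Real.mul_self_sqrt hν]
  have hc : ν * c = ν * √(c : ℝ) ^ 2 := by rw [Real.sq_sqrt (Nat.cast_nonneg c)]
  linarith [h.one_sub_eq, h.add_le]

end ProgressBound


/-- Lemma `bound_ab`: for the progress-measure sequences `(a_t)`,
`(b_t)` driven by a set `T_q ⊆ {1,…,τ}` of quantum steps (`|T_q| = τq`) and
classical steps `T_c = {1,…,τ} \ T_q` (`|T_c| = τc`), with `0 ≤ z_t ≤ b_t`,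
we have `a_τ ≥ 1 − 4ν(√τc + τq)²` and `b_τ ≤ ν(√τc + 2τq)²`. -/
theorem bound_ab (ν : ℝ) (hν : 0 ≤ ν) (τc τq τ : ℕ) (hτ : τ = τc + τq)
    (Tq : Finset ℕ) (hTq : Tq ⊆ Finset.Icc 1 τ) (hTqcard : Tq.card = τq)
    (z a b : ℕ → ℝ)
    (ha0 : a 0 = 1) (hb0 : b 0 = 0)
    (hz : ∀ t, t < τ → 0 ≤ z t ∧ z t ≤ b t)
    (hrec : ∀ t, t < τ →
      (t + 1 ∈ Tq →
        a (t + 1) = a t - 4 * ν - 4 * Real.sqrt ν * Real.sqrt (b t) ∧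
        b (t + 1) = b t + 4 * ν + 4 * Real.sqrt ν * Real.sqrt (b t)) ∧
      (t + 1 ∉ Tq →
        a (t + 1) = a t - 2 * ν - 2 * Real.sqrt ν * Real.sqrt (z t) ∧
        b (t + 1) = b t + ν - z t)) :
    a τ ≥ 1 - 4 * ν * (Real.sqrt τc + τq) ^ 2 ∧
      b τ ≤ ν * (Real.sqrt τc + 2 * τq) ^ 2 := by
  have key : ∀ t ≤ τ, ∃ W Z, ProgressBound ν (a t) (b t)
      (Finset.Icc 1 t \ Tq).card (Finset.Icc 1 t ∩ Tq).card W Z := by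
    intro t
    induction t with
    | zero => exact fun _ ↦ ⟨0, 0, by constructor <;> simp [ha0, hb0]⟩
    | succ t ih =>
      intro ht
      obtain ⟨W, Z, h⟩ := ih (by omega)
      obtain ⟨hquantum, hclassical⟩ := hrec t ht
      have hIcc : Finset.Icc 1 (t + 1) = insert (t + 1) (Finset.Icc 1 t) :=
        (Finset.insert_Icc_right_eq_Icc_add_one (by omega)).symm
      by_cases hmem : t + 1 ∈ Tq
      · obtain ⟨ha, hb⟩ := hquantum hmem
        rw [ha, hb, hIcc, Finset.insert_sdiff_of_mem _ hmem, Finset.insert_inter_of_mem hmem,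
          Finset.card_insert_of_notMem (by simp)]
        exact ⟨W, Z, h.quantum_step hν⟩
      · obtain ⟨ha, hb⟩ := hclassical hmem
        rw [ha, hb, hIcc, Finset.insert_sdiff_of_notMem _ hmem,
          Finset.insert_inter_of_notMem hmem, Finset.card_insert_of_notMem (by simp)]
        exact ⟨_, _, h.classical_step hν (hz t ht).1 (hz t ht).2⟩
  obtain ⟨W, Z, h⟩ := key τ le_rfl
  have hcard : (Finset.Icc 1 τ \ Tq).card = τc := by
    rw [Finset.card_sdiff_of_subset hTq, Nat.card_Icc]
    omega
  rw [hcard, Finset.inter_eq_right.mpr hTq, hTqcard] at h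
  exact ⟨h.le_left hν, by linarith [h.add_le, h.sum_nonneg]⟩
end

section
/- Fix a real number ν ≥ 0 and a natural number τ. A strategy is a function s : {1,…,τ} → {0,1} (0 = classical query, 1 = quantum query). The sequence (d^s_t)_{0 ≤ t ≤ τ} is defined by d^s_0 = 0 and d^s_{t+1} = d^s_t + ν if s(t+1) = 0, and d^s_{t+1} = d^s_t + 4ν + 4√(ν·d^s_t) if s(t+1) = 1. Then for every strategy s with exactly τc zeros and τq ones (τc + τq = τ), it holds that d^s_τ ≤ ν·(√τc + 2τq)². -/
theorem Finset.card_filter_Icc_one_succ (p : ℕ → Prop) [DecidablePred p] (t : ℕ) :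
    ((Finset.Icc 1 (t + 1)).filter p).card =
      ((Finset.Icc 1 t).filter p).card + if p (t + 1) then 1 else 0 := by
  rw [← Finset.insert_Icc_right_eq_Icc_add_one (by omega), Finset.filter_insert]
  split_ifs <;> simp

/-- A classical query costs at most one more unit under the square root. -/
theorem sq_sqrt_add_two_mul_add_one_le (c q : ℕ) :
    (Real.sqrt c + 2 * q) ^ 2 + 1 ≤ (Real.sqrt (c + 1) + 2 * q) ^ 2 := by
  have h₁ : Real.sqrt c ^ 2 = c := Real.sq_sqrt (by positivity)
  have h₂ : Real.sqrt ((c : ℝ) + 1) ^ 2 = c + 1 := Real.sq_sqrt (by positivity)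
  have h₃ : Real.sqrt c ≤ Real.sqrt ((c : ℝ) + 1) := Real.sqrt_le_sqrt (by linarith)
  have h₄ := mul_le_mul_of_nonneg_left h₃ (Nat.cast_nonneg (α := ℝ) q)
  nlinarith

/-- A quantum query raises the square root of the bound by at most `2√ν`. -/
theorem add_four_mul_sqrt_le {ν x y : ℝ} (hν : 0 ≤ ν) (hy : 0 ≤ y) (h : x ≤ ν * y ^ 2) :
    x + 4 * ν + 4 * Real.sqrt (ν * x) ≤ ν * (y + 2) ^ 2 := by
  have hs : Real.sqrt (ν * x) ≤ ν * y := by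
    refine Real.sqrt_le_iff.mpr ⟨by positivity, ?_⟩
    calc ν * x ≤ ν * (ν * y ^ 2) := mul_le_mul_of_nonneg_left h hν
      _ = (ν * y) ^ 2 := by ring
  linarith [show ν * (y + 2) ^ 2 = ν * y ^ 2 + 4 * ν + 4 * (ν * y) by ring]

/-- step (1) of Lemma `bound_ab`: for any strategy
`s : {1,…,τ} → {0,1}` (here `false` = classical query, `true` = quantum query)
with exactly `τc` classical and `τq` quantum queries, the sequence
`d_0 = 0`, `d_{t+1} = d_t + ν` on classical steps and
`d_{t+1} = d_t + 4ν + 4√(ν d_t)` on quantum steps satisfies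
`d_τ ≤ ν(√τc + 2τq)²`. -/
theorem d_seq_bound (ν : ℝ) (hν : 0 ≤ ν) (τ τc τq : ℕ) (hτ : τc + τq = τ)
    (s : ℕ → Bool)
    (hzeros : ((Finset.Icc 1 τ).filter (fun t => s t = false)).card = τc)
    (hones : ((Finset.Icc 1 τ).filter (fun t => s t = true)).card = τq)
    (d : ℕ → ℝ) (hd0 : d 0 = 0)
    (hrec : ∀ t, t < τ →
      d (t + 1) = if s (t + 1) = false then d t + ν
        else d t + 4 * ν + 4 * Real.sqrt (ν * d t)) :
    d τ ≤ ν * (Real.sqrt τc + 2 * τq) ^ 2 := by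
  have key : ∀ t, t ≤ τ → d t ≤ ν *
      (Real.sqrt ((Finset.Icc 1 t).filter (fun t => s t = false)).card +
        2 * ((Finset.Icc 1 t).filter (fun t => s t = true)).card) ^ 2 := by
    intro t
    induction t with
    | zero => simp [hd0]
    | succ t ih =>
      intro ht
      have ih := ih (by omega)
      rw [hrec t (by omega), Finset.card_filter_Icc_one_succ, Finset.card_filter_Icc_one_succ]
      generalize ((Finset.Icc 1 t).filter (fun t => s t = false)).card = c at ih ⊢
      generalize ((Finset.Icc 1 t).filter (fun t => s t = true)).card = q at ih ⊢
      cases hs : s (t + 1)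
      · simp only [if_true, Bool.false_eq_true, if_false, add_zero, Nat.cast_add, Nat.cast_one]
        linarith [mul_le_mul_of_nonneg_left (sq_sqrt_add_two_mul_add_one_le c q) hν]
      · simp only [if_true, Bool.true_eq_false, if_false, add_zero, Nat.cast_add, Nat.cast_one]
        convert add_four_mul_sqrt_le hν (by positivity) ih using 2
        ring
  simpa only [hzeros, hones] using key τ le_rfl
end

section
/- Fix a real number ν > 0 and a natural number τ. A strategy is a function s : {1,…,τ} → {0,1} (0 = classical query, 1 = quantum query). The sequence (d^s_t)_{0 ≤ t ≤ τ} is defined by d^s_0 = 0 and d^s_{t+1} = d^s_t + ν if s(t+1) = 0, and d^s_{t+1} = d^s_t + 4ν + 4√(ν·d^s_t) if s(t+1) = 1. Let s be a strategy with s(i) = 0 and s(i+1) = 1 for some 1 ≤ i < τ, and let s' be the strategy obtained from s by swapping the values at positions i and i+1 (so s'(i) = 1, s'(i+1) = 0, and s'(j) = s(j) for j ∉ {i, i+1}). Then d^s_τ > d^{s'}_τ. -/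
/-- swap lemma, greedy-exchange step in Lemma `bound_ab`: if the
strategy `s` makes a classical query at position `i` followed by a quantum query
at position `i+1` (here `false` = classical = 0, `true` = quantum = 1), and `s'`
is obtained from `s` by swapping these two positions, then the final values of
the associated sequences satisfy `d_τ > d'_τ`. -/
theorem d_seq_swap (ν : ℝ) (hν : 0 < ν) (τ : ℕ) (s s' : ℕ → Bool)
    (i : ℕ) (hi1 : 1 ≤ i) (hiτ : i < τ)
    (hsi : s i = false) (hsi1 : s (i + 1) = true)
    (hs'i : s' i = true) (hs'i1 : s' (i + 1) = false)
    (hagree : ∀ j, j ≠ i → j ≠ i + 1 → s' j = s j)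
    (d d' : ℕ → ℝ) (hd0 : d 0 = 0) (hd'0 : d' 0 = 0)
    (hrec : ∀ t, t < τ →
      d (t + 1) = if s (t + 1) = false then d t + ν
        else d t + 4 * ν + 4 * Real.sqrt (ν * d t))
    (hrec' : ∀ t, t < τ →
      d' (t + 1) = if s' (t + 1) = false then d' t + ν
        else d' t + 4 * ν + 4 * Real.sqrt (ν * d' t)) :
    d τ > d' τ := by
  obtain ⟨k, rfl⟩ : ∃ k, i = k + 1 := ⟨i - 1, by omega⟩
  have nonneg' : ∀ t, t ≤ τ → 0 ≤ d' t := by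
    intro t
    induction t with
    | zero => intro _; exact hd'0.ge
    | succ t ih =>
      intro ht
      have := ih (by omega)
      rw [hrec' t (by omega)]
      split_ifs <;> positivity
  have eq_before : ∀ t, t ≤ k → d t = d' t := by
    intro t
    induction t with
    | zero => intro _; rw [hd0, hd'0]
    | succ t ih =>
      intro ht
      rw [hrec t (by omega), hrec' t (by omega), ih (by omega),
        hagree (t + 1) (by omega) (by omega)]
  have swap_lt : d' (k + 1 + 1) < d (k + 1 + 1) := by
    have hk := nonneg' k (by omega)
    have hsqrt : √(ν * d' k) < √(ν * (d' k + ν)) :=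
      Real.sqrt_lt_sqrt (by positivity) (by gcongr; linarith)
    rw [hrec (k + 1) hiτ, hrec' (k + 1) hiτ, hrec k (by omega), hrec' k (by omega),
      hsi, hsi1, hs'i, hs'i1, eq_before k le_rfl]
    simp only [if_true, Bool.true_eq_false, if_false]
    linarith
  have lt_after : ∀ t, k + 1 + 1 ≤ t → t ≤ τ → d' t < d t := by
    intro t hkt
    induction t, hkt using Nat.le_induction with
    | base => intro _; exact swap_lt
    | succ t hkt ih =>
      intro ht
      have hlt := ih (by omega)
      rw [hrec t (by omega), hrec' t (by omega), hagree (t + 1) (by omega) (by omega)]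
      have hsqrt : √(ν * d' t) ≤ √(ν * d t) := by gcongr
      split_ifs <;> linarith
  exact lt_after τ hiτ le_rfl
end

section
/- Fix a real number ν ≥ 0 and natural numbers τc, τq with τ = τc + τq. Fix a set T_q ⊆ {1,…,τ} with |T_q| = τq ('quantum' steps) and let T_c = {1,…,τ} \ T_q ('classical' steps, |T_c| = τc). Let (z_t)_{0 ≤ t < τ} be real numbers and define sequences (a_t)_{0 ≤ t ≤ τ} and (b_t)_{0 ≤ t ≤ τ} by: a_0 = 1, b_0 = 0; if t+1 ∈ T_c then a_{t+1} = a_t − 2ν − 2√ν·√(z_t) and b_{t+1} = b_t + ν − z_t; if t+1 ∈ T_q then a_{t+1} = a_t − 4ν − 4√ν·√(b_t) and b_{t+1} = b_t + 4ν + 4√ν·√(b_t). Assume 0 ≤ z_t ≤ b_t for all 0 ≤ t < τ. Then Σ_{t ∈ T_q} √(b_{t−1}) ≤ √ν · τq · (√τc + τq − 1). -/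
open Finset in
/-- A sum over a subset of `{1, …, n}` as a sum of shifted terms over `range n`. -/
theorem sum_subset_Icc_eq_sum_range_ite {M : Type*} [AddCommMonoid M] {n : ℕ} {s : Finset ℕ}
    (hs : s ⊆ Icc 1 n) (f : ℕ → M) :
    ∑ t ∈ s, f t = ∑ i ∈ range n, if i + 1 ∈ s then f (i + 1) else 0 := by
  rw [← sum_filter]
  refine sum_nbij' (fun t => t - 1) (fun i => i + 1) ?_ ?_ ?_ ?_ ?_
  · intro t ht
    have := mem_Icc.1 (hs ht)
    simp only [mem_filter, mem_range]
    rw [Nat.sub_add_cancel this.1]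
    exact ⟨by omega, ht⟩
  · intro i hi
    exact (mem_filter.1 hi).2
  · intro t ht
    exact Nat.sub_add_cancel (mem_Icc.1 (hs ht)).1
  · intro i _
    rfl
  · intro t ht
    rw [Nat.sub_add_cancel (mem_Icc.1 (hs ht)).1]

/-- A quantum step raises `√b` by exactly `2√ν`. -/
theorem sqrt_quantum_step {ν b : ℝ} (hν : 0 ≤ ν) (hb : 0 ≤ b) :
    √(b + 4 * ν + 4 * √ν * √b) = √b + 2 * √ν := by
  rw [Real.sqrt_eq_iff_mul_self_eq (by positivity) (by positivity)]
  linear_combination -Real.mul_self_sqrt hb - 4 * Real.mul_self_sqrt hν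

/-- A classical step preserves bounds of the form `√b ≤ √ν (√c + x)` with `c` increased by one. -/
theorem sqrt_classical_step {ν b z c x : ℝ} (hν : 0 ≤ ν) (hz : 0 ≤ z) (hc : 0 ≤ c)
    (hx : 0 ≤ x) (h : √b ≤ √ν * (√c + x)) :
    √(b + ν - z) ≤ √ν * (√(c + 1) + x) := by
  refine Real.sqrt_le_iff.2 ⟨by positivity, ?_⟩
  have hb' : b ≤ (√ν * (√c + x)) ^ 2 := (Real.sqrt_le_iff.1 h).2
  have hcc : √c * x ≤ √(c + 1) * x :=
    mul_le_mul_of_nonneg_right (Real.sqrt_le_sqrt (by linarith)) hx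
  rw [mul_pow, Real.sq_sqrt hν] at hb' ⊢
  have key : (√c + x) ^ 2 + 1 ≤ (√(c + 1) + x) ^ 2 := by
    linarith [Real.sq_sqrt hc, Real.sq_sqrt (by linarith : 0 ≤ c + 1), add_sq √c x,
      add_sq √(c + 1) x]
  linarith [mul_le_mul_of_nonneg_left key hν]


/-- step (2) of Lemma `bound_ab`: under the progress-measure
recurrences driven by the quantum-step set `T_q ⊆ {1,…,τ}` and the classical
steps `T_c = {1,…,τ} \ T_q`, with `0 ≤ z_t ≤ b_t`, the quantum contributions
satisfy `Σ_{t ∈ T_q} √(b_{t−1}) ≤ √ν · τq · (√τc + τq − 1)`. -/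
theorem quantum_contribution_bound (ν : ℝ) (hν : 0 ≤ ν)
    (τc τq τ : ℕ) (hτ : τ = τc + τq)
    (Tq : Finset ℕ) (hTq : Tq ⊆ Finset.Icc 1 τ) (hTqcard : Tq.card = τq)
    (z a b : ℕ → ℝ)
    (ha0 : a 0 = 1) (hb0 : b 0 = 0)
    (hz : ∀ t, t < τ → 0 ≤ z t ∧ z t ≤ b t)
    (hrec : ∀ t, t < τ →
      (t + 1 ∈ Tq →
        a (t + 1) = a t - 4 * ν - 4 * Real.sqrt ν * Real.sqrt (b t) ∧
        b (t + 1) = b t + 4 * ν + 4 * Real.sqrt ν * Real.sqrt (b t)) ∧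
      (t + 1 ∉ Tq →
        a (t + 1) = a t - 2 * ν - 2 * Real.sqrt ν * Real.sqrt (z t) ∧
        b (t + 1) = b t + ν - z t)) :
    ∑ t ∈ Tq, Real.sqrt (b (t - 1)) ≤
      Real.sqrt ν * τq * (Real.sqrt τc + τq - 1) := by
  set Q : ℕ → ℕ := fun t => ∑ i ∈ Finset.range t, if i + 1 ∈ Tq then 1 else 0 with hQ
  set C : ℕ → ℕ := fun t => ∑ i ∈ Finset.range t, if i + 1 ∈ Tq then 0 else 1 with hC
  have hQτ : Q τ = τq := by
    rw [← hTqcard, Finset.card_eq_sum_ones, sum_subset_Icc_eq_sum_range_ite hTq]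
  have hCQ : C τ + Q τ = τ := by
    simp only [hC, hQ, ← Finset.sum_add_distrib]
    calc _ = ∑ i ∈ Finset.range τ, 1 := Finset.sum_congr rfl fun i _ => by split_ifs <;> rfl
      _ = τ := by simp
  have hCle : ∀ t, t ≤ τ → C t ≤ τc := fun t ht =>
    calc C t ≤ C τ := Finset.sum_le_sum_of_subset (Finset.range_mono ht)
      _ = τc := by omega
  have hinv : ∀ t, t ≤ τ → √(b t) ≤ √ν * (√(C t) + 2 * Q t) ∧
      (∑ i ∈ Finset.range t, if i + 1 ∈ Tq then √(b i) else 0) ≤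
        √ν * Q t * (√τc + Q t - 1) := by
    intro t
    induction t with
    | zero => simp [hb0, hQ, hC]
    | succ t ih =>
      intro ht
      obtain ⟨hb, hS⟩ := ih (by omega)
      obtain ⟨hz0, hzb⟩ := hz t (by omega)
      have hbt : 0 ≤ b t := hz0.trans hzb
      rw [Finset.sum_range_succ]
      by_cases hmem : t + 1 ∈ Tq
      · have hQs : Q (t + 1) = Q t + 1 := by
          simp only [hQ, Finset.sum_range_succ, hmem, if_true]
        have hCs : C (t + 1) = C t := by simp [hC, Finset.sum_range_succ, hmem]
        rw [(((hrec t (by omega)).1 hmem).2), sqrt_quantum_step hν hbt, hQs, hCs, if_pos hmem]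
        push_cast
        refine ⟨by linarith, ?_⟩
        have hCτ : √(C t : ℝ) ≤ √τc :=
          Real.sqrt_le_sqrt (by exact_mod_cast hCle t (by omega))
        linarith [mul_le_mul_of_nonneg_left hCτ (Real.sqrt_nonneg ν)]
      · have hQs : Q (t + 1) = Q t := by
          simp only [hQ, Finset.sum_range_succ, hmem, if_false, add_zero]
        have hCs : C (t + 1) = C t + 1 := by simp [hC, Finset.sum_range_succ, hmem]
        rw [(((hrec t (by omega)).2 hmem).2), hQs, hCs, if_neg hmem, add_zero]
        push_cast
        exact ⟨sqrt_classical_step hν hz0 (by positivity) (by positivity) hb, hS⟩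
  rw [sum_subset_Icc_eq_sum_range_ite hTq, ← hQτ]
  simpa only [Nat.add_sub_cancel] using (hinv τ le_rfl).2
end

section
/- Fix a real number ν ≥ 0 and natural numbers τc, τq with τ = τc + τq. Fix a set T_q ⊆ {1,…,τ} with |T_q| = τq ('quantum' steps) and let T_c = {1,…,τ} \ T_q ('classical' steps, |T_c| = τc). Let (z_t)_{0 ≤ t < τ} be real numbers and define sequences (a_t)_{0 ≤ t ≤ τ} and (b_t)_{0 ≤ t ≤ τ} by: a_0 = 1, b_0 = 0; if t+1 ∈ T_c then a_{t+1} = a_t − 2ν − 2√ν·√(z_t) and b_{t+1} = b_t + ν − z_t; if t+1 ∈ T_q then a_{t+1} = a_t − 4ν − 4√ν·√(b_t) and b_{t+1} = b_t + 4ν + 4√ν·√(b_t). Assume 0 ≤ z_t ≤ b_t for all 0 ≤ t < τ. Then Σ_{t ∈ T_c} √(z_{t−1}) ≤ √ν · (τc + 2·τq·√τc). -/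
theorem Icc_one_add_one_eq_insert (t : ℕ) :
    Finset.Icc 1 (t + 1) = insert (t + 1) (Finset.Icc 1 t) := by
  ext x
  simp only [Finset.mem_Icc, Finset.mem_insert]
  omega

/-- The potential `b t` plus the total amount `z` removed by classical steps is at most
`ν (√c + 2 q)²`, where `c` and `q` count the classical and quantum steps made so far. -/
theorem potential_add_sum_le {ν : ℝ} (hν : 0 ≤ ν) {τ : ℕ} {Tq : Finset ℕ} {z b : ℕ → ℝ}
    (hb0 : b 0 = 0) (hz : ∀ t, t < τ → 0 ≤ z t ∧ z t ≤ b t)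
    (hquantum : ∀ t, t < τ → t + 1 ∈ Tq →
      b (t + 1) = b t + 4 * ν + 4 * Real.sqrt ν * Real.sqrt (b t))
    (hclassical : ∀ t, t < τ → t + 1 ∉ Tq → b (t + 1) = b t + ν - z t)
    {t : ℕ} (ht : t ≤ τ) :
    0 ≤ b t ∧ b t + ∑ s ∈ Finset.Icc 1 t \ Tq, z (s - 1) ≤
      ν * (Real.sqrt ((Finset.Icc 1 t \ Tq).card) + 2 * (Finset.Icc 1 t ∩ Tq).card) ^ 2 := by
  induction t with
  | zero => simp [hb0]
  | succ t ih =>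
    obtain ⟨hb, hle⟩ := ih (by omega)
    have hlt : t < τ := by omega
    have hsum : 0 ≤ ∑ s ∈ Finset.Icc 1 t \ Tq, z (s - 1) := by
      refine Finset.sum_nonneg fun s hs => (hz _ ?_).1
      simp only [Finset.mem_sdiff, Finset.mem_Icc] at hs
      omega
    have hnew : t + 1 ∉ Finset.Icc 1 t := by simp
    have hν2 := Real.sq_sqrt hν
    have hsν := Real.sqrt_nonneg ν
    rw [Icc_one_add_one_eq_insert]
    by_cases hmem : t + 1 ∈ Tq
    · rw [Finset.insert_sdiff_of_mem _ hmem, Finset.insert_inter_of_mem hmem,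
        Finset.card_insert_of_notMem (by simp), hquantum t hlt hmem]
      refine ⟨by positivity, ?_⟩
      set S := ∑ s ∈ Finset.Icc 1 t \ Tq, z (s - 1)
      set c := Real.sqrt ((Finset.Icc 1 t \ Tq).card : ℝ)
      have hc : 0 ≤ c := Real.sqrt_nonneg _
      push_cast
      set q : ℝ := ((Finset.Icc 1 t ∩ Tq).card : ℝ)
      have hq : 0 ≤ q := Nat.cast_nonneg _
      have hsqrt : Real.sqrt (b t) ≤ Real.sqrt ν * (c + 2 * q) := by
        refine Real.sqrt_le_iff.2 ⟨by positivity, ?_⟩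
        rw [mul_pow, hν2]
        linarith
      have hmul := mul_le_mul_of_nonneg_left hsqrt hsν
      rw [← mul_assoc, ← sq, hν2] at hmul
      linarith
    · have hnot : t + 1 ∉ Finset.Icc 1 t \ Tq := fun h => hnew (Finset.mem_sdiff.1 h).1
      rw [Finset.insert_sdiff_of_notMem _ hmem, Finset.insert_inter_of_notMem hmem,
        Finset.card_insert_of_notMem hnot, Finset.sum_insert hnot, hclassical t hlt hmem,
        Nat.add_sub_cancel]
      refine ⟨by linarith [(hz t hlt).2], ?_⟩
      push_cast
      set n : ℝ := ((Finset.Icc 1 t \ Tq).card : ℝ)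
      have hn : 0 ≤ n := Nat.cast_nonneg _
      set q : ℝ := ((Finset.Icc 1 t ∩ Tq).card : ℝ)
      have hq : 0 ≤ q := Nat.cast_nonneg _
      have hmono : Real.sqrt n ≤ Real.sqrt (n + 1) := Real.sqrt_le_sqrt (by linarith)
      have hstep : (Real.sqrt n + 2 * q) ^ 2 + 1 ≤ (Real.sqrt (n + 1) + 2 * q) ^ 2 := by
        have h₁ := Real.sq_sqrt hn
        have h₂ := Real.sq_sqrt (show 0 ≤ n + 1 by linarith)
        nlinarith [mul_le_mul_of_nonneg_left hmono hq]
      have hmul := mul_le_mul_of_nonneg_left hstep hν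
      linarith

/-- step (3) of Lemma `bound_ab`: under the progress-measure
recurrences driven by the quantum-step set `T_q ⊆ {1,…,τ}` and the classical
steps `T_c = {1,…,τ} \ T_q`, with `0 ≤ z_t ≤ b_t`, the classical contributions
satisfy `Σ_{t ∈ T_c} √(z_{t−1}) ≤ √ν · (τc + 2τq√τc)`. -/
theorem classical_contribution_bound (ν : ℝ) (hν : 0 ≤ ν)
    (τc τq τ : ℕ) (hτ : τ = τc + τq)
    (Tq : Finset ℕ) (hTq : Tq ⊆ Finset.Icc 1 τ) (hTqcard : Tq.card = τq)
    (z a b : ℕ → ℝ)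
    (ha0 : a 0 = 1) (hb0 : b 0 = 0)
    (hz : ∀ t, t < τ → 0 ≤ z t ∧ z t ≤ b t)
    (hrec : ∀ t, t < τ →
      (t + 1 ∈ Tq →
        a (t + 1) = a t - 4 * ν - 4 * Real.sqrt ν * Real.sqrt (b t) ∧
        b (t + 1) = b t + 4 * ν + 4 * Real.sqrt ν * Real.sqrt (b t)) ∧
      (t + 1 ∉ Tq →
        a (t + 1) = a t - 2 * ν - 2 * Real.sqrt ν * Real.sqrt (z t) ∧
        b (t + 1) = b t + ν - z t)) :
    ∑ t ∈ Finset.Icc 1 τ \ Tq, Real.sqrt (z (t - 1)) ≤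
      Real.sqrt ν * (τc + 2 * τq * Real.sqrt τc) := by
  have hcardq : (Finset.Icc 1 τ ∩ Tq).card = τq := by
    rw [Finset.inter_eq_right.2 hTq, hTqcard]
  have hcardc : (Finset.Icc 1 τ \ Tq).card = τc := by
    rw [Finset.card_sdiff_of_subset hTq, hTqcard, Nat.card_Icc]
    omega
  obtain ⟨hb, hle⟩ := potential_add_sum_le hν hb0 hz
    (fun t ht h => ((hrec t ht).1 h).2) (fun t ht h => ((hrec t ht).2 h).2) le_rfl
  rw [hcardq, hcardc] at hle
  have hsq : ∑ t ∈ Finset.Icc 1 τ \ Tq, Real.sqrt (z (t - 1)) ^ 2 =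
      ∑ t ∈ Finset.Icc 1 τ \ Tq, z (t - 1) := by
    refine Finset.sum_congr rfl fun s hs => Real.sq_sqrt (hz _ ?_).1
    simp only [Finset.mem_sdiff, Finset.mem_Icc] at hs
    omega
  have hcs := sq_sum_le_card_mul_sum_sq (s := Finset.Icc 1 τ \ Tq)
    (f := fun t => Real.sqrt (z (t - 1)))
  rw [hsq, hcardc] at hcs
  have hc : (0 : ℝ) ≤ τc := Nat.cast_nonneg _
  refine (sq_le_sq₀ (Finset.sum_nonneg fun _ _ => Real.sqrt_nonneg _) (by positivity)).1 ?_
  calc (∑ t ∈ Finset.Icc 1 τ \ Tq, Real.sqrt (z (t - 1))) ^ 2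
      ≤ τc * (ν * (Real.sqrt τc + 2 * τq) ^ 2) :=
        hcs.trans (mul_le_mul_of_nonneg_left (by linarith) hc)
    _ = (Real.sqrt ν * (Real.sqrt τc ^ 2 + 2 * τq * Real.sqrt τc)) ^ 2 := by
        nth_rewrite 1 [← Real.sq_sqrt hc]
        nth_rewrite 1 [← Real.sq_sqrt hν]
        ring
    _ = (Real.sqrt ν * (τc + 2 * τq * Real.sqrt τc)) ^ 2 := by rw [Real.sq_sqrt hc]
end

section
/- Let X and Y be nonempty finite types and let H be drawn uniformly at random from the set of all functions X → Y. Then Σ_{z ∈ Y} E_H [ | (|H⁻¹(z)| / |X|) − 1/|Y| | ] ≤ √(|Y| / |X|), where |H⁻¹(z)| denotes the number of elements x ∈ X with H(x) = z, and E_H denotes the average over all |Y|^{|X|} functions H : X → Y. -/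
open Finset in
/-- Under a uniformly random function, the value at `x` is independent of the other values. -/
theorem sum_fun_mul_restrict {X Y : Type*} [Fintype X] [Fintype Y] [DecidableEq X]
    (x : X) (f : Y → ℝ) (g : ({j // j ≠ x} → Y) → ℝ) :
    ∑ H : X → Y, f (H x) * g (fun j => H j) = (∑ y, f y) * ∑ K, g K := by
  rw [sum_mul_sum, ← Fintype.sum_prod_type']
  exact Fintype.sum_equiv (Equiv.funSplitAt x Y) _ _ fun H => rfl

open Finset in
/-- The variance of a sum of independent centred variables `c (H x)`. -/
theorem card_mul_sum_sq_sum_apply {X Y : Type*} [Fintype X] [Fintype Y] [DecidableEq X]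
    (c : Y → ℝ) (hc : ∑ y, c y = 0) :
    (Fintype.card Y : ℝ) * ∑ H : X → Y, (∑ x, c (H x)) ^ 2
      = Fintype.card (X → Y) * (Fintype.card X * ∑ y, c y ^ 2) := by
  have hdiag (x : X) : (Fintype.card Y : ℝ) * ∑ H : X → Y, c (H x) ^ 2
      = Fintype.card (X → Y) * ∑ y, c y ^ 2 := by
    have h := sum_fun_mul_restrict x (fun y => c y ^ 2) fun _ => 1
    have h1 := sum_fun_mul_restrict (Y := Y) x (fun _ => 1) fun _ => 1
    simp only [mul_one, sum_const, card_univ, nsmul_eq_mul] at h h1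
    rw [h, h1]
    ring
  have hoff (x x' : X) (hx : x' ≠ x) : ∑ H : X → Y, c (H x) * c (H x') = 0 := by
    have h := sum_fun_mul_restrict x c fun K => c (K ⟨x', hx⟩)
    rwa [hc, zero_mul] at h
  have hsq : ∑ H : X → Y, (∑ x, c (H x)) ^ 2 = ∑ x, ∑ H : X → Y, c (H x) ^ 2 := by
    simp_rw [sq, sum_mul_sum]
    rw [sum_comm]
    refine sum_congr rfl fun x _ => ?_
    rw [sum_comm]
    exact sum_eq_single x (fun x' _ hx => hoff x x' hx) (by simp)
  rw [hsq, mul_sum, sum_congr rfl fun x _ => hdiag x]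
  simp only [sum_const, card_univ, nsmul_eq_mul]
  ring

open Finset in
/-- The mean deviation of the relative fibre size is at most the standard deviation bound. -/
theorem mean_abs_fiber_deviation_le {X Y : Type*} [Fintype X] [Fintype Y]
    [DecidableEq X] [DecidableEq Y] [Nonempty X] [Nonempty Y] (z : Y) :
    (∑ H : X → Y, |(#{x | H x = z} : ℝ) / Fintype.card X - 1 / Fintype.card Y|)
        / Fintype.card (X → Y)
      ≤ √(1 / (Fintype.card X * Fintype.card Y)) := by
  have hm : (0 : ℝ) < Fintype.card X := by exact_mod_cast Fintype.card_pos
  have hk : (0 : ℝ) < Fintype.card Y := by exact_mod_cast Fintype.card_pos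
  have hN : (0 : ℝ) < Fintype.card (X → Y) := by exact_mod_cast Fintype.card_pos
  set m := (Fintype.card X : ℝ)
  set k := (Fintype.card Y : ℝ)
  set N := (Fintype.card (X → Y) : ℝ)
  let c : Y → ℝ := fun y => (if y = z then 1 else 0) - 1 / k
  have hc : ∑ y, c y = 0 := by
    simp only [c, sum_sub_distrib, sum_ite_eq', mem_univ, if_true, sum_const, card_univ,
      nsmul_eq_mul]
    change 1 - k * (1 / k) = 0
    field_simp
    ring
  have hc2 : ∑ y, c y ^ 2 ≤ 1 := by
    have h (y : Y) : c y ^ 2 = (if y = z then 1 - 1 / k else 0) - 1 / k * c y := by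
      simp only [c]
      split_ifs <;> ring
    rw [sum_congr rfl fun y _ => h y, sum_sub_distrib, ← mul_sum, hc]
    simp only [sum_ite_eq', mem_univ, if_true, mul_zero, sub_zero]
    have : 0 < 1 / k := by positivity
    linarith
  have hdev (H : X → Y) : (#{x | H x = z} : ℝ) / m - 1 / k = (∑ x, c (H x)) / m := by
    simp only [c, sum_sub_distrib, sum_boole, sum_const, card_univ, nsmul_eq_mul]
    change _ = (_ - m * (1 / k)) / m
    field_simp
  have hvar : k * ∑ H : X → Y, (∑ x, c (H x)) ^ 2 ≤ N * m := by
    rw [card_mul_sum_sq_sum_apply c hc]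
    exact mul_le_mul_of_nonneg_left (mul_le_of_le_one_right hm.le hc2) hN.le
  have hcs : (∑ H : X → Y, |∑ x, c (H x)|) ^ 2 ≤ N * ∑ H : X → Y, (∑ x, c (H x)) ^ 2 := by
    have h := sq_sum_le_card_mul_sum_sq (s := univ) (f := fun H : X → Y => |∑ x, c (H x)|)
    simpa only [sq_abs, card_univ] using h
  simp_rw [hdev, abs_div, abs_of_pos hm, ← sum_div]
  refine Real.le_sqrt_of_sq_le ?_
  rw [div_div, div_pow, div_le_div_iff₀ (by positivity) (by positivity)]
  calc _ ≤ (N * ∑ H : X → Y, (∑ x, c (H x)) ^ 2) * (m * k) := by gcongr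
    _ = N * m * (k * ∑ H : X → Y, (∑ x, c (H x)) ^ 2) := by ring
    _ ≤ N * m * (N * m) := by gcongr
    _ = 1 * (m * N) ^ 2 := by ring

/-- statistical-distance bound in the reduction of Lemma `proof_ow`:
for a uniformly random function `H : X → Y`,
`Σ_{z ∈ Y} E_H |( |H⁻¹(z)| / |X| ) − 1/|Y|| ≤ √(|Y|/|X|)`. -/
theorem random_function_sd_bound {X Y : Type*} [Fintype X] [Fintype Y]
    [DecidableEq X] [DecidableEq Y] [Nonempty X] [Nonempty Y] :
    ∑ z : Y, (∑ H : X → Y,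
        |((Finset.univ.filter (fun x => H x = z)).card : ℝ) / (Fintype.card X : ℝ)
          - 1 / (Fintype.card Y : ℝ)|) / (Fintype.card (X → Y) : ℝ)
      ≤ Real.sqrt ((Fintype.card Y : ℝ) / (Fintype.card X : ℝ)) := by
  refine (Finset.sum_le_sum fun z _ => mean_abs_fiber_deviation_le z).trans_eq ?_
  have hm : (0 : ℝ) < Fintype.card X := by exact_mod_cast Fintype.card_pos
  have hk : (0 : ℝ) < Fintype.card Y := by exact_mod_cast Fintype.card_pos
  rw [Finset.sum_const, Finset.card_univ, nsmul_eq_mul, eq_comm,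
    Real.sqrt_eq_iff_mul_self_eq (by positivity) (by positivity), mul_mul_mul_comm,
    Real.mul_self_sqrt (by positivity)]
  field_simp
end
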